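/- Let u : ℝ × ℝ → ℝ be concave (jointly, on all of ℝ × ℝ), and assume that for each fixed t ∈ ℝ the map s ↦ u(t, s) is strictly antitone. Let κ : ℝ → ℝ be a function satisfying u(t, κ(t)) = 0 for every t ∈ ℝ. Then κ is concave. -/

import Mathlib

/-- If `u` is jointly concave and strictly decreasing in its second argument,
then the implicitly defined function `κ` with `u (t, κ t) = 0` is concave. -/
theorem stmt_1
    (u : ℝ × ℝ → ℝ) (hconc : ConcaveOn ℝ Set.univ u)
    (hanti : ∀ t : ℝ, StrictAnti fun s => u (t, s))
    (κ : ℝ → ℝ) (hκ : ∀ t : ℝ, u (t, κ t) = 0) :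
    ConcaveOn ℝ Set.univ κ := by
  refine ⟨convex_univ, fun x _ y _ a b ha hb hab => ?_⟩
  have hu := hconc.2 (Set.mem_univ (x, κ x)) (Set.mem_univ (y, κ y)) ha hb hab
  simp only [hκ, smul_zero, add_zero, Prod.smul_mk, Prod.mk_add_mk] at hu
  by_contra! hlt
  have hneg := hanti (a • x + b • y) hlt
  simp only [hκ] at hneg
  exact hneg.not_ge hu
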